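/- Assume f satisfies (f1), (f2), (f3) and (f4), let 0 < a < b < ∞, and let u₁ and u₂ be two positive solutions of (R) with 0 < u₁'(a) < u₂'(a). If r̄₁(M₁) < r̄₂(M₁), then r̄₁ and r̄₂ intersect in (B, M₁), i.e. there exists s ∈ (B, M₁) with r̄₁(s) = r̄₂(s). -/

import Mathlib

open Set Filter MeasureTheory

/-- `F(s) = ∫₀ˢ f(t) dt`. -/
noncomputable def Fint (f : ℝ → ℝ) (s : ℝ) : ℝ := ∫ t in (0:ℝ)..s, f t

/-- Condition (f1): `f` is continuous on `[0,∞)`, continuously differentiable on `(0,∞)`,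
and `f' ∈ L¹(0,1)`. -/
def CondF1 (f : ℝ → ℝ) : Prop :=
  ContinuousOn f (Ici 0) ∧ (∀ s ∈ Ioi (0:ℝ), DifferentiableAt ℝ f s) ∧
  ContinuousOn (deriv f) (Ioi 0) ∧ IntervalIntegrable (deriv f) volume 0 1

/-- Condition (f2) in the case `β > B > 0`. -/
def CondF2B (f : ℝ → ℝ) (β B : ℝ) : Prop :=
  f 0 = 0 ∧ 0 < B ∧ B < β ∧ (∀ s, B < s → 0 < f s) ∧
  (∀ s ∈ Icc (0:ℝ) B, f s ≤ 0) ∧ (∃ ε > (0:ℝ), ∀ s ∈ Ioo (0:ℝ) ε, f s < 0) ∧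
  Fint f β = 0

/-- Condition (f2): either `β = B = 0` and `f > 0` on `(0,∞)`, or `β > B > 0` with the
sign conditions and `F(β) = 0`. -/
def CondF2 (f : ℝ → ℝ) (β B : ℝ) : Prop :=
  (β = 0 ∧ B = 0 ∧ f 0 = 0 ∧ ∀ s, 0 < s → 0 < f s) ∨ CondF2B f β B

/-- Condition (f3): the derivative of `s ↦ F(s)/f(s)` is `≥ (n-2)/(2n)` for every `s > β`. -/
def CondF3 (n : ℕ) (f : ℝ → ℝ) (β : ℝ) : Prop :=
  ∀ s, β < s → ∃ d, ((n : ℝ) - 2) / (2 * (n : ℝ)) ≤ d ∧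
    HasDerivAt (fun t => Fint f t / f t) d s

/-- Condition (f4): superlinearity `f(s) ≤ f'(s)(s - B)` for `s > B`, with
`f(s) ≢ f'(s)(s - B)` on `[B, β]`. -/
def CondF4 (f : ℝ → ℝ) (β B : ℝ) : Prop :=
  (∀ s, B < s → f s ≤ deriv f s * (s - B)) ∧
  ¬ (∀ s ∈ Icc B β, f s = deriv f s * (s - B))

/-- A positive solution of problem (R) on the annulus `a < |x| < b`:
`u` is continuous on `[a,b]`, differentiable up to the boundary with derivative `u'`
(one-sided at the endpoints), `u'` is continuous on `[a,b]`, `u` is twice continuously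
differentiable on `(a,b)` where it satisfies `u'' + ((n-1)/r) u' + f(u) = 0`,
`u(a) = u(b) = 0` and `u > 0` on `(a,b)`. -/
def IsPosSolAnn (n : ℕ) (a b : ℝ) (f u u' : ℝ → ℝ) : Prop :=
  ContinuousOn u (Icc a b) ∧
  (∀ r ∈ Icc a b, HasDerivWithinAt u (u' r) (Icc a b) r) ∧
  ContinuousOn u' (Icc a b) ∧
  (∀ r ∈ Ioo a b, HasDerivAt u (u' r) r) ∧
  (∀ r ∈ Ioo a b, HasDerivAt u' (-(((n : ℝ) - 1) / r * u' r + f (u r))) r) ∧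
  u a = 0 ∧ u b = 0 ∧ (∀ r ∈ Ioo a b, 0 < u r)

/-- A positive solution of the exterior problem (R) with `b = ∞`:
`u` is continuous on `[a,∞)`, differentiable on `[a,∞)` with derivative `u'`
(one-sided at `a`), twice continuously differentiable on `(a,∞)` where it satisfies
`u'' + ((n-1)/r) u' + f(u) = 0`, `u(a) = 0`, `u > 0` on `(a,∞)` and `u(r) → 0` as `r → ∞`. -/
def IsPosSolExt (n : ℕ) (a : ℝ) (f u u' : ℝ → ℝ) : Prop :=
  ContinuousOn u (Ici a) ∧
  (∀ r ∈ Ici a, HasDerivWithinAt u (u' r) (Ici a) r) ∧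
  (∀ r ∈ Ioi a, HasDerivAt u (u' r) r) ∧
  (∀ r ∈ Ioi a, HasDerivAt u' (-(((n : ℝ) - 1) / r * u' r + f (u r))) r) ∧
  u a = 0 ∧ (∀ r ∈ Ioi a, 0 < u r) ∧
  Tendsto u atTop (nhds 0)

/-- The Erbe–Tang functional
`P(s) = -2n (F(s)/f(s)) ρ(s)^{n-1} u'(ρ(s)) - ρ(s)^n (u'(ρ(s)))² - 2 ρ(s)^n F(s)`,
where `ρ` is an inverse branch of the solution `u` with derivative `u'`. -/
noncomputable def Pfun (n : ℕ) (f : ℝ → ℝ) (ρ u' : ℝ → ℝ) (s : ℝ) : ℝ :=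
  -2 * (n : ℝ) * (Fint f s / f s) * (ρ s) ^ (n - 1) * u' (ρ s)
    - (ρ s) ^ n * (u' (ρ s)) ^ 2 - 2 * (ρ s) ^ n * Fint f s

lemma key_lt (j : ℕ) (r₁ r₂ p₁ p₂ φ : ℝ) (hr2 : 0 < r₂) (hr : r₂ ≤ r₁) (hp2 : 0 ≤ p₂)
    (hE : 0 ≤ p₁ ^ 2 + 2 * φ)
    (hH : r₁ ^ (2 * j + 2) * (p₁ ^ 2 + 2 * φ) < r₂ ^ (2 * j + 2) * (p₂ ^ 2 + 2 * φ)) :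
    p₁ < p₂ := by
  by_contra hcon
  push Not at hcon
  have h1 : r₂ ^ (2 * j + 2) ≤ r₁ ^ (2 * j + 2) := by gcongr
  have h2 : p₂ ^ 2 + 2 * φ ≤ p₁ ^ 2 + 2 * φ := by gcongr
  have h3 : 0 < r₂ ^ (2 * j + 2) := by positivity
  have h4 : r₂ ^ (2 * j + 2) * (p₂ ^ 2 + 2 * φ) ≤ r₂ ^ (2 * j + 2) * (p₁ ^ 2 + 2 * φ) := by
    gcongr
  have h5 : r₂ ^ (2 * j + 2) * (p₁ ^ 2 + 2 * φ) ≤ r₁ ^ (2 * j + 2) * (p₁ ^ 2 + 2 * φ) := by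
    gcongr
  linarith

lemma deriv_H (j : ℕ) (f Φ r p : ℝ → ℝ) (Φ' s : ℝ) (hr : HasDerivAt r (1 / p s) s)
    (hp : HasDerivAt p (-(((j : ℝ) + 1) / r s) - f s / p s) s) (hΦ : HasDerivAt Φ Φ' s)
    (hr0 : 0 < r s) (hp0 : 0 < p s) :
    HasDerivAt (fun s => r s ^ (2 * j + 2) * (p s ^ 2 + 2 * Φ s))
      (2 * r s ^ (2 * j + 2) * (Φ' - f s)
        + 4 * ((j : ℝ) + 1) * (r s ^ (2 * j + 1) / p s) * Φ s) s := by
  have h := (hr.pow (2 * j + 2)).mul ((hp.pow 2).add (hΦ.const_mul 2))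
  refine h.congr_deriv ?_
  simp only [Pi.pow_apply, Pi.add_apply]
  push_cast
  field_simp
  ring

lemma phase (j : ℕ) (f Φ Φ' r₁ r₂ p₁ p₂ : ℝ → ℝ) (l h : ℝ)
    (cr1 : ContinuousOn r₁ (Icc l h)) (cr2 : ContinuousOn r₂ (Icc l h))
    (cp1 : ContinuousOn p₁ (Icc l h)) (cp2 : ContinuousOn p₂ (Icc l h))
    (cΦ : ContinuousOn Φ (Icc l h))
    (dr1 : ∀ s ∈ Ioo l h, HasDerivAt r₁ (1 / p₁ s) s)
    (dr2 : ∀ s ∈ Ioo l h, HasDerivAt r₂ (1 / p₂ s) s)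
    (dp1 : ∀ s ∈ Ioo l h, HasDerivAt p₁ (-(((j : ℝ) + 1) / r₁ s) - f s / p₁ s) s)
    (dp2 : ∀ s ∈ Ioo l h, HasDerivAt p₂ (-(((j : ℝ) + 1) / r₂ s) - f s / p₂ s) s)
    (dΦ : ∀ s ∈ Ioo l h, HasDerivAt Φ (Φ' s) s)
    (hΦ' : ∀ s ∈ Ioo l h, Φ' s ≤ f s) (hΦ : ∀ s ∈ Ioo l h, Φ s ≤ 0)
    (r2pos : ∀ s ∈ Icc l h, 0 < r₂ s)
    (p1pos : ∀ s ∈ Ico l h, 0 < p₁ s) (p2nn : ∀ s ∈ Icc l h, 0 ≤ p₂ s)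
    (hE : ∀ s ∈ Icc l h, 0 ≤ p₁ s ^ 2 + 2 * Φ s)
    (i1 : r₂ l ≤ r₁ l)
    (i2 : r₁ l ^ (2 * j + 2) * (p₁ l ^ 2 + 2 * Φ l) < r₂ l ^ (2 * j + 2) * (p₂ l ^ 2 + 2 * Φ l)) :
    ∀ s ∈ Icc l h, r₂ s ≤ r₁ s ∧ (l < s → r₂ s < r₁ s) ∧
      r₁ s ^ (2 * j + 2) * (p₁ s ^ 2 + 2 * Φ s) < r₂ s ^ (2 * j + 2) * (p₂ s ^ 2 + 2 * Φ s) ∧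
      p₁ s < p₂ s := by
  have step : ∀ t ∈ Icc l h, (∀ s ∈ Ico l t, p₁ s < p₂ s) → r₂ t ≤ r₁ t ∧ (l < t → r₂ t < r₁ t) ∧
      r₁ t ^ (2 * j + 2) * (p₁ t ^ 2 + 2 * Φ t) < r₂ t ^ (2 * j + 2) * (p₂ t ^ 2 + 2 * Φ t) ∧
      p₁ t < p₂ t := by
    intro t ht hlt
    have sub : Icc l t ⊆ Icc l h := Icc_subset_Icc_right ht.2
    have sub' : Ioo l t ⊆ Ioo l h := Ioo_subset_Ioo_right ht.2
    have mono : StrictMonoOn (fun s => r₁ s - r₂ s) (Icc l t) := by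
      apply strictMonoOn_of_deriv_pos (convex_Icc l t) ((cr1.sub cr2).mono sub)
      intro s hs
      rw [interior_Icc] at hs
      rw [((dr1 s (sub' hs)).sub (dr2 s (sub' hs))).deriv]
      have a1 := p1pos s ⟨hs.1.le, (sub' hs).2⟩
      have a2 := hlt s ⟨hs.1.le, hs.2⟩
      have := one_div_lt_one_div_of_lt a1 a2
      linarith
    have hle : ∀ s ∈ Icc l t, r₂ s ≤ r₁ s := by
      intro s hs
      have := mono.monotoneOn (left_mem_Icc.2 ht.1) hs hs.1
      try simp only at this
      linarith
    have hst : l < t → r₂ t < r₁ t := by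
      intro hh
      have := mono (left_mem_Icc.2 ht.1) (right_mem_Icc.2 ht.1) hh
      try simp only at this
      linarith
    have monoH : MonotoneOn (fun s => r₂ s ^ (2 * j + 2) * (p₂ s ^ 2 + 2 * Φ s)
        - r₁ s ^ (2 * j + 2) * (p₁ s ^ 2 + 2 * Φ s)) (Icc l t) := by
      have dd : ∀ s ∈ Ioo l t, HasDerivAt (fun s => r₂ s ^ (2 * j + 2) * (p₂ s ^ 2 + 2 * Φ s)
        - r₁ s ^ (2 * j + 2) * (p₁ s ^ 2 + 2 * Φ s))
          ((2 * r₂ s ^ (2 * j + 2) * (Φ' s - f s)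
        + 4 * ((j : ℝ) + 1) * (r₂ s ^ (2 * j + 1) / p₂ s) * Φ s) - (2 * r₁ s ^ (2 * j + 2) * (Φ' s - f s)
        + 4 * ((j : ℝ) + 1) * (r₁ s ^ (2 * j + 1) / p₁ s) * Φ s)) s := by
        intro s hs
        have a1 := p1pos s ⟨hs.1.le, (sub' hs).2⟩
        have a2 := hlt s ⟨hs.1.le, hs.2⟩
        have b2 := r2pos s (sub (Ioo_subset_Icc_self hs))
        have b1 := hle s (Ioo_subset_Icc_self hs)
        exact (deriv_H j f Φ r₂ p₂ _ s (dr2 s (sub' hs)) (dp2 s (sub' hs)) (dΦ s (sub' hs)) b2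
          (a1.trans a2)).sub (deriv_H j f Φ r₁ p₁ _ s (dr1 s (sub' hs)) (dp1 s (sub' hs))
          (dΦ s (sub' hs)) (b2.trans_le b1) a1)
      apply monotoneOn_of_deriv_nonneg (convex_Icc l t)
      · exact ContinuousOn.mono (by fun_prop) sub
      · intro s hs
        rw [interior_Icc] at hs
        exact (dd s hs).differentiableAt.differentiableWithinAt
      · intro s hs
        rw [interior_Icc] at hs
        rw [(dd s hs).deriv]
        have a1 := p1pos s ⟨hs.1.le, (sub' hs).2⟩
        have a2 := hlt s ⟨hs.1.le, hs.2⟩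
        have b2 := r2pos s (sub (Ioo_subset_Icc_self hs))
        have b1 := hle s (Ioo_subset_Icc_self hs)
        have e1 : r₂ s ^ (2 * j + 2) ≤ r₁ s ^ (2 * j + 2) := by gcongr
        have b3 := b2.trans_le b1
        have e2 : r₂ s ^ (2 * j + 1) / p₂ s ≤ r₁ s ^ (2 * j + 1) / p₁ s := by gcongr
        have f1 := mul_nonneg (sub_nonneg.2 e1) (sub_nonneg.2 (hΦ' s (sub' hs)))
        have f2 := mul_nonneg (mul_nonneg (sub_nonneg.2 e2) (neg_nonneg.2 (hΦ s (sub' hs))))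
          (by positivity : (0:ℝ) ≤ (j : ℝ) + 1)
        linarith
    have hH : r₁ t ^ (2 * j + 2) * (p₁ t ^ 2 + 2 * Φ t)
        < r₂ t ^ (2 * j + 2) * (p₂ t ^ 2 + 2 * Φ t) := by
      have := monoH (left_mem_Icc.2 ht.1) (right_mem_Icc.2 ht.1) ht.1
      try simp only at this
      linarith
    exact ⟨hle t (right_mem_Icc.2 ht.1), hst, hH,
      key_lt j _ _ _ _ _ (r2pos t ht) (hle t (right_mem_Icc.2 ht.1)) (p2nn t ht) (hE t ht) hH⟩
  have all : ∀ s ∈ Icc l h, p₁ s < p₂ s := by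
    by_contra hcon
    push Not at hcon
    obtain ⟨s, hs, hsp⟩ := hcon
    have hcl : IsClosed (Icc l h ∩ (fun s => p₁ s - p₂ s) ⁻¹' (Ici 0)) :=
      (cp1.sub cp2).preimage_isClosed_of_isClosed isClosed_Icc isClosed_Ici
    have hcpt : IsCompact (Icc l h ∩ (fun s => p₁ s - p₂ s) ⁻¹' (Ici 0)) :=
      isCompact_Icc.of_isClosed_subset hcl inter_subset_left
    obtain ⟨t, ht, hmin⟩ := hcpt.exists_isLeast ⟨s, hs, by simp; linarith⟩
    have := (step t ht.1 ?_).2.2.2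
    · have h2 := ht.2
      simp at h2
      linarith
    · intro x hx
      by_contra hc
      have : t ≤ x := hmin ⟨⟨hx.1, hx.2.le.trans ht.1.2⟩, by simp; linarith⟩
      linarith [hx.2]
  exact fun t ht => step t ht fun s hs => all s ⟨hs.1, hs.2.le.trans ht.2⟩

/-- inverse of the increasing branch -/
lemma branch (j : ℕ) (f u u' : ℝ → ℝ) (a b c M : ℝ) (hc : c ∈ Ioo a b)
    (cu : ContinuousOn u (Icc a b)) (cu' : ContinuousOn u' (Icc a b))
    (du : ∀ r ∈ Ioo a b, HasDerivAt u (u' r) r)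
    (du' : ∀ r ∈ Ioo a b, HasDerivAt u' (-(((j : ℝ) + 1) / r * u' r + f (u r))) r)
    (ua : u a = 0) (up : ∀ r ∈ Ico a c, 0 < u' r) (hM : M = u c) :
    StrictMonoOn u (Icc a c) ∧ 0 < M ∧ ∃ ρ : ℝ → ℝ,
      (∀ s ∈ Icc 0 M, ρ s ∈ Icc a c ∧ u (ρ s) = s) ∧ (∀ r ∈ Icc a c, ρ (u r) = r) ∧
      ContinuousOn ρ (Icc 0 M) ∧ ContinuousOn (fun s => u' (ρ s)) (Icc 0 M) ∧
      (∀ s ∈ Ico 0 M, 0 < u' (ρ s)) ∧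
      (∀ s ∈ Ioo 0 M, HasDerivAt ρ (1 / u' (ρ s)) s) ∧
      (∀ s ∈ Ioo 0 M, HasDerivAt (fun s => u' (ρ s))
        (-(((j : ℝ) + 1) / ρ s) - f s / u' (ρ s)) s) := by
  have sub : Icc a c ⊆ Icc a b := Icc_subset_Icc_right hc.2.le
  have mono : StrictMonoOn u (Icc a c) := by
    apply strictMonoOn_of_deriv_pos (convex_Icc a c) (cu.mono sub)
    intro s hs
    rw [interior_Icc] at hs
    rw [(du s ⟨hs.1, hs.2.trans hc.2⟩).deriv]
    exact up s ⟨hs.1.le, hs.2⟩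
  have hMpos : 0 < M := by
    rw [hM, ← ua]
    exact mono (left_mem_Icc.2 hc.1.le) (right_mem_Icc.2 hc.1.le) hc.1
  refine ⟨mono, hMpos, Function.invFunOn u (Icc a c), ?_⟩
  set ρ := Function.invFunOn u (Icc a c) with hρ
  have surj : ∀ s ∈ Icc 0 M, ∃ r ∈ Icc a c, u r = s := by
    intro s hs
    have := intermediate_value_Icc hc.1.le (cu.mono sub)
    rw [ua, ← hM] at this
    obtain ⟨r, hr, e⟩ := this hs
    exact ⟨r, hr, e⟩
  have P1 : ∀ s ∈ Icc 0 M, ρ s ∈ Icc a c ∧ u (ρ s) = s := fun s hs =>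
    ⟨Function.invFunOn_mem (surj s hs), Function.invFunOn_eq (surj s hs)⟩
  have umem : ∀ r ∈ Icc a c, u r ∈ Icc 0 M := by
    intro r hr
    constructor
    · rw [← ua]; exact mono.monotoneOn (left_mem_Icc.2 hc.1.le) hr hr.1
    · rw [hM]; exact mono.monotoneOn hr (right_mem_Icc.2 hc.1.le) hr.2
  have P2 : ∀ r ∈ Icc a c, ρ (u r) = r := fun r hr =>
    mono.injOn (P1 _ (umem r hr)).1 hr (P1 _ (umem r hr)).2
  have ρmono : StrictMonoOn ρ (Icc 0 M) := by
    intro s hs t ht hst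
    by_contra hcon
    push Not at hcon
    have := mono.monotoneOn (P1 t ht).1 (P1 s hs).1 hcon
    rw [(P1 t ht).2, (P1 s hs).2] at this
    linarith
  have img : ρ '' Icc 0 M = Icc a c := by
    ext r
    constructor
    · rintro ⟨s, hs, rfl⟩; exact (P1 s hs).1
    · intro hr; exact ⟨u r, umem r hr, P2 r hr⟩
  have cρ : ContinuousOn ρ (Icc 0 M) := by
    let e := ρmono.orderIso ρ (Icc 0 M)
    have hce : Continuous (fun x : Icc 0 M => ((e x : ρ '' Icc 0 M) : ℝ)) := by
      have : OrdConnected (ρ '' Icc 0 M) := by rw [img]; exact ordConnected_Icc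
      exact continuous_subtype_val.comp e.continuous
    rw [continuousOn_iff_continuous_domRestrict]
    exact hce
  have Pint : ∀ s ∈ Ioo 0 M, ρ s ∈ Ioo a c := by
    intro s hs
    have h0 := ρmono (left_mem_Icc.2 hMpos.le) (Ioo_subset_Icc_self hs) hs.1
    have h1 := ρmono (Ioo_subset_Icc_self hs) (right_mem_Icc.2 hMpos.le) hs.2
    have e0 := P2 a (left_mem_Icc.2 hc.1.le)
    have e1 := P2 c (right_mem_Icc.2 hc.1.le)
    rw [ua] at e0
    rw [← hM] at e1
    exact ⟨by linarith, by linarith⟩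
  have Pdρ : ∀ s ∈ Ioo 0 M, HasDerivAt ρ (1 / u' (ρ s)) s := by
    intro s hs
    have hi := Pint s hs
    rw [one_div]
    apply HasDerivAt.of_local_left_inverse (f := u)
    · exact cρ.continuousAt (Icc_mem_nhds hs.1 hs.2)
    · exact du _ ⟨hi.1, hi.2.trans hc.2⟩
    · exact (up _ ⟨hi.1.le, hi.2⟩).ne'
    · filter_upwards [Icc_mem_nhds hs.1 hs.2] with x hx using (P1 x hx).2
  refine ⟨P1, P2, cρ, ?_, ?_, Pdρ, ?_⟩
  · exact cu'.comp cρ fun s hs => sub (P1 s hs).1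
  · intro s hs
    have h1 := ρmono ⟨hs.1, hs.2.le⟩ (right_mem_Icc.2 hMpos.le) hs.2
    have e1 := P2 c (right_mem_Icc.2 hc.1.le)
    rw [← hM] at e1
    exact up _ ⟨(P1 s ⟨hs.1, hs.2.le⟩).1.1, by linarith⟩
  · intro s hs
    have hi := Pint s hs
    have h := (du' _ ⟨hi.1, hi.2.trans hc.2⟩).comp s (Pdρ s hs)
    have hpos := up _ ⟨hi.1.le, hi.2⟩
    rw [(P1 s (Ioo_subset_Icc_self hs)).2] at h
    refine h.congr_deriv ?_
    generalize ((j : ℝ) + 1) / ρ s = A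
    field_simp
    ring

lemma Fint_facts (f : ℝ → ℝ) (hf : ContinuousOn f (Ici 0)) :
    ContinuousOn (Fint f) (Ici 0) ∧ ∀ s, 0 < s → HasDerivAt (Fint f) (f s) s := by
  have hg : Continuous (fun t : ℝ => f (max t 0)) :=
    hf.comp_continuous (by fun_prop) fun x => by simp
  have hd : ∀ s, HasDerivAt (Fint fun t => f (max t 0)) (f (max s 0)) s := fun s =>
    (hg.integral_hasStrictDerivAt 0 s).hasDerivAt
  have heq : ∀ s, 0 ≤ s → Fint f s = Fint (fun t => f (max t 0)) s := by
    intro s hs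
    apply intervalIntegral.integral_congr
    intro t ht
    rw [uIcc_of_le hs] at ht
    simp [max_eq_left ht.1]
  constructor
  · have : ContinuousOn (Fint fun t => f (max t 0)) (Ici 0) := fun s _ =>
      (hd s).continuousAt.continuousWithinAt
    exact this.congr fun s hs => heq s hs
  · intro s hs
    have := hd s
    rw [max_eq_left hs.le] at this
    apply this.congr_of_eventuallyEq
    filter_upwards [Ioi_mem_nhds hs] with x hx using heq x (le_of_lt hx)

lemma Fint_neg (f : ℝ → ℝ) (β B : ℝ) (hf : ContinuousOn f (Ici 0)) (h2 : CondF2B f β B) :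
    ∀ s ∈ Ioo 0 β, Fint f s < 0 := by
  obtain ⟨-, hB, hBβ, hpos, hneg, ⟨ε, hε, hεneg⟩, hβ⟩ := h2
  obtain ⟨cF, dF⟩ := Fint_facts f hf
  have F0 : Fint f 0 = 0 := by simp [Fint]
  intro s hs
  rcases le_or_gt s B with hsB | hsB
  · have h1 : StrictAntiOn (Fint f) (Icc 0 (min s ε)) := by
      apply strictAntiOn_of_deriv_neg (convex_Icc _ _) (cF.mono Icc_subset_Ici_self)
      intro x hx
      rw [interior_Icc] at hx
      rw [(dF x hx.1).deriv]
      exact hεneg x ⟨hx.1, hx.2.trans_le (min_le_right _ _)⟩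
    have h2 : AntitoneOn (Fint f) (Icc 0 B) := by
      apply antitoneOn_of_deriv_nonpos (convex_Icc _ _) (cF.mono Icc_subset_Ici_self)
      · intro x hx
        rw [interior_Icc] at hx
        exact (dF x hx.1).differentiableAt.differentiableWithinAt
      · intro x hx
        rw [interior_Icc] at hx
        rw [(dF x hx.1).deriv]
        exact hneg x ⟨hx.1.le, hx.2.le⟩
    have hm : 0 < min s ε := lt_min hs.1 hε
    have e1 := h1 (left_mem_Icc.2 hm.le) (right_mem_Icc.2 hm.le) hm
    have e2 := h2 ⟨hm.le, (min_le_left _ _).trans hsB⟩ ⟨hs.1.le, hsB⟩ (min_le_left s ε)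
    linarith
  · have h1 : StrictMonoOn (Fint f) (Icc B β) := by
      apply strictMonoOn_of_deriv_pos (convex_Icc _ _)
        (cF.mono fun x hx => hB.le.trans hx.1)
      intro x hx
      rw [interior_Icc] at hx
      rw [(dF x (hB.trans hx.1)).deriv]
      exact hpos x hx.1
    have := h1 ⟨hsB.le, hs.2.le⟩ (right_mem_Icc.2 hBβ.le) hs.2
    linarith

lemma energy (k : ℝ) (hk : 0 ≤ k) (f u u' : ℝ → ℝ) (a b : ℝ) (ha : 0 < a) (hab : a < b)
    (hf : ContinuousOn f (Ici 0))
    (cu : ContinuousOn u (Icc a b)) (cu' : ContinuousOn u' (Icc a b))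
    (du : ∀ r ∈ Ioo a b, HasDerivAt u (u' r) r)
    (du' : ∀ r ∈ Ioo a b, HasDerivAt u' (-(k / r * u' r + f (u r))) r)
    (ua : u a = 0) (ub : u b = 0) (upos : ∀ r ∈ Ioo a b, 0 < u r) :
    ∀ r ∈ Icc a b, 0 ≤ u' r ^ 2 + 2 * Fint f (u r) := by
  obtain ⟨cF, dF⟩ := Fint_facts f hf
  have unn : ∀ r ∈ Icc a b, 0 ≤ u r := by
    intro r hr
    rcases eq_or_lt_of_le hr.1 with h | h
    · rw [← h, ua]
    rcases eq_or_lt_of_le hr.2 with h' | h'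
    · rw [h', ub]
    exact (upos r ⟨h, h'⟩).le
  have cFu : ContinuousOn (fun r => Fint f (u r)) (Icc a b) := cF.comp cu unn
  have dd : ∀ r ∈ Ioo a b, HasDerivAt (fun r => u' r ^ 2 + 2 * Fint f (u r))
      (-(2 * (k / r) * u' r ^ 2)) r := by
    intro r hr
    have h := ((du' r hr).pow 2).add (((dF _ (upos r hr)).comp r (du r hr)).const_mul 2)
    refine h.congr_deriv ?_
    push_cast
    ring
  have anti : AntitoneOn (fun r => u' r ^ 2 + 2 * Fint f (u r)) (Icc a b) := by
    apply antitoneOn_of_deriv_nonpos (convex_Icc _ _) (by fun_prop)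
    · intro x hx
      rw [interior_Icc] at hx
      exact (dd x hx).differentiableAt.differentiableWithinAt
    · intro x hx
      rw [interior_Icc] at hx
      rw [(dd x hx).deriv]
      have : 0 < x := ha.trans hx.1
      have : 0 ≤ 2 * (k / x) * u' x ^ 2 := by positivity
      linarith
  intro r hr
  have := anti hr (right_mem_Icc.2 hab.le) hr.2
  simp only [ub] at this
  have F0 : Fint f 0 = 0 := by simp [Fint]
  rw [F0] at this
  nlinarith [sq_nonneg (u' b)]

lemma superlin (f : ℝ → ℝ) (B : ℝ) (hB : 0 < B) (hd : ∀ s ∈ Ioi (0:ℝ), DifferentiableAt ℝ f s)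
    (h4 : ∀ s, B < s → f s ≤ deriv f s * (s - B)) :
    ∀ s t, B < s → s ≤ t → f s * (t - B) ≤ f t * (s - B) := by
  have dd : ∀ s ∈ Ioi B, HasDerivAt (fun s => f s / (s - B))
      ((deriv f s * (s - B) - f s * 1) / (s - B) ^ 2) s := by
    intro s hs
    have hs' : B < s := hs
    exact ((hd s (hB.trans hs')).hasDerivAt).div ((hasDerivAt_id s).sub_const B)
      (sub_pos.2 hs').ne'
  have mono : MonotoneOn (fun s => f s / (s - B)) (Ioi B) := by
    apply monotoneOn_of_deriv_nonneg (convex_Ioi B)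
    · exact fun s hs => (dd s hs).continuousAt.continuousWithinAt
    · intro s hs
      rw [interior_Ioi] at hs
      exact (dd s hs).differentiableAt.differentiableWithinAt
    · intro s hs
      rw [interior_Ioi] at hs
      rw [(dd s hs).deriv]
      have := h4 s hs
      apply div_nonneg _ (sq_nonneg _)
      linarith
  intro s t hs hst
  have ht := hs.trans_le hst
  have h := mono hs ht hst
  simp only at h
  rwa [div_le_div_iff₀ (sub_pos.2 hs) (sub_pos.2 ht)] at h

/-- Sturm comparison: `u₂ > u₁ > B` on an interval where `u₁ = B` at both ends is impossible. -/
lemma sturm (j : ℕ) (f u₁ u₁' u₂ u₂' : ℝ → ℝ) (B l e : ℝ) (hl : 0 < l) (hle : l < e)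
    (hg : ∀ s t, B < s → s ≤ t → f s * (t - B) ≤ f t * (s - B))
    (cu1 : ContinuousOn u₁ (Icc l e)) (cu1' : ContinuousOn u₁' (Icc l e))
    (cu2 : ContinuousOn u₂ (Icc l e)) (cu2' : ContinuousOn u₂' (Icc l e))
    (du1 : ∀ r ∈ Ioo l e, HasDerivAt u₁ (u₁' r) r)
    (du1' : ∀ r ∈ Ioo l e, HasDerivAt u₁' (-(((j : ℝ) + 1) / r * u₁' r + f (u₁ r))) r)
    (du2 : ∀ r ∈ Ioo l e, HasDerivAt u₂ (u₂' r) r)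
    (du2' : ∀ r ∈ Ioo l e, HasDerivAt u₂' (-(((j : ℝ) + 1) / r * u₂' r + f (u₂ r))) r)
    (hB : ∀ r ∈ Ioo l e, B < u₁ r) (h12 : ∀ r ∈ Ico l e, u₁ r < u₂ r)
    (e1 : u₁ l = B) (e2 : u₁ e = B) (s1 : 0 < u₁' l) (s2 : u₁' e ≤ 0) : False := by
  have dd : ∀ r ∈ Ioo l e, HasDerivAt
      (fun r => r ^ (j + 1) * (u₁' r * (u₂ r - B) - u₂' r * (u₁ r - B)))
      (r ^ (j + 1) * (f (u₂ r) * (u₁ r - B) - f (u₁ r) * (u₂ r - B))) r := by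
    intro r hr
    have hr0 : 0 < r := hl.trans hr.1
    have h := (hasDerivAt_pow (j + 1) r).mul
      (((du1' r hr).mul ((du2 r hr).sub_const B)).sub ((du2' r hr).mul ((du1 r hr).sub_const B)))
    refine h.congr_deriv ?_
    simp only [Pi.mul_apply, Pi.sub_apply, Nat.add_sub_cancel]
    push_cast
    field_simp
    ring
  have mono : MonotoneOn (fun r => r ^ (j + 1) * (u₁' r * (u₂ r - B) - u₂' r * (u₁ r - B)))
      (Icc l e) := by
    apply monotoneOn_of_deriv_nonneg (convex_Icc _ _) (by fun_prop)
    · intro x hx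
      rw [interior_Icc] at hx
      exact (dd x hx).differentiableAt.differentiableWithinAt
    · intro x hx
      rw [interior_Icc] at hx
      rw [(dd x hx).deriv]
      have hx0 : 0 < x := hl.trans hx.1
      have := hg _ _ (hB x hx) (h12 x ⟨hx.1.le, hx.2⟩).le
      exact mul_nonneg (by positivity) (by linarith)
  have h := mono (left_mem_Icc.2 hle.le) (right_mem_Icc.2 hle.le) hle.le
  simp only [e1, e2, sub_self, mul_zero, sub_zero] at h
  have a1 : 0 < u₂ l - B := by
    have := h12 l ⟨le_rfl, hle⟩
    linarith
  have a2 : 0 ≤ u₂ e - B := by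
    have hc : ContinuousWithinAt u₂ (Ioo l e) e :=
      (cu2 e (right_mem_Icc.2 hle.le)).mono Ioo_subset_Icc_self
    have hne : (nhdsWithin e (Ioo l e)).NeBot := by
      rw [← mem_closure_iff_nhdsWithin_neBot, closure_Ioo hle.ne]
      exact right_mem_Icc.2 hle.le
    have : B ≤ u₂ e := by
      apply ge_of_tendsto hc
      filter_upwards [self_mem_nhdsWithin] with x hx
      exact ((hB x hx).trans (h12 x ⟨hx.1.le, hx.2⟩)).le
    linarith
  have b1 : 0 < l ^ (j + 1) * (u₁' l * (u₂ l - B)) := by positivity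
  have he : 0 < e := hl.trans hle
  have b2 : e ^ (j + 1) * (u₁' e * (u₂ e - B)) ≤ 0 :=
    mul_nonpos_of_nonneg_of_nonpos (by positivity) (mul_nonpos_of_nonpos_of_nonneg s2 a2)
  linarith

/-- Step six (Proposition 3.7): under (f1)–(f4), if `r̄₁(M₁) < r̄₂(M₁)` then
`r̄₁` and `r̄₂` intersect in `(B, M₁)`. -/
theorem step_six_annulus
    (n : ℕ) (hn : 2 ≤ n) (f : ℝ → ℝ) (β B : ℝ)
    (hf1 : CondF1 f) (hf2 : CondF2 f β B) (hf3 : CondF3 n f β) (hf4 : CondF4 f β B)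
    (a b : ℝ) (ha : 0 < a) (hab : a < b)
    (u₁ u₁' u₂ u₂' : ℝ → ℝ)
    (h₁ : IsPosSolAnn n a b f u₁ u₁') (h₂ : IsPosSolAnn n a b f u₂ u₂')
    (hslope₁ : 0 < u₁' a) (hslope₁₂ : u₁' a < u₂' a)
    (c₁ c₂ : ℝ) (hc₁ : c₁ ∈ Ioo a b) (hc₂ : c₂ ∈ Ioo a b)
    (hc₁up : ∀ r ∈ Ico a c₁, 0 < u₁' r) (hc₁down : ∀ r ∈ Ioo c₁ b, u₁' r < 0)
    (hc₂up : ∀ r ∈ Ico a c₂, 0 < u₂' r) (hc₂down : ∀ r ∈ Ioo c₂ b, u₂' r < 0)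
    (M₁ M₂ : ℝ) (hM₁ : M₁ = u₁ c₁) (hM₂ : M₂ = u₂ c₂)
    (rb₁ rb₂ : ℝ → ℝ)
    (hrb₁mem : ∀ s ∈ Icc (0:ℝ) M₁, rb₁ s ∈ Icc c₁ b ∧ u₁ (rb₁ s) = s)
    (hrb₁inv : ∀ r ∈ Icc c₁ b, rb₁ (u₁ r) = r)
    (hrb₂mem : ∀ s ∈ Icc (0:ℝ) M₂, rb₂ s ∈ Icc c₂ b ∧ u₂ (rb₂ s) = s)
    (hrb₂inv : ∀ r ∈ Icc c₂ b, rb₂ (u₂ r) = r)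
    (hlt : rb₁ M₁ < rb₂ M₁) :
    ∃ s ∈ Ioo B M₁, rb₁ s = rb₂ s := by
  obtain ⟨j, rfl⟩ : ∃ j, n = j + 2 := ⟨n - 2, by omega⟩
  have hcast : ((j + 2 : ℕ) : ℝ) - 1 = (j : ℝ) + 1 := by push_cast; ring
  obtain ⟨cu1, -, cu1', du1, du1', u1a, u1b, u1pos⟩ := h₁
  obtain ⟨cu2, -, cu2', du2, du2', u2a, u2b, u2pos⟩ := h₂
  rw [hcast] at du1' du2'
  obtain ⟨cf, df, -, -⟩ := hf1
  obtain ⟨hf4a, hf4b⟩ := hf4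
  rcases hf2 with ⟨hβ0, hB0, hf0, -⟩ | hf2
  · exfalso
    apply hf4b
    intro s hs
    have : s = 0 := le_antisymm (by linarith [hs.2]) (by linarith [hs.1])
    rw [this, hB0, hf0]
    simp
  have Fneg := Fint_neg f β B cf hf2
  obtain ⟨cF, dF⟩ := Fint_facts f cf
  have F0 : Fint f 0 = 0 := by simp [Fint]
  obtain ⟨hf0, hB, hBβ, fpos, -, -, hFβ⟩ := hf2
  have hβ : 0 < β := hB.trans hBβ
  have E1 := energy ((j : ℝ) + 1) (by positivity) f u₁ u₁' a b ha hab cf cu1 cu1' du1 du1' u1a u1b u1pos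
  have E2 := energy ((j : ℝ) + 1) (by positivity) f u₂ u₂' a b ha hab cf cu2 cu2' du2 du2' u2a u2b u2pos
  have crit : ∀ (u u' : ℝ → ℝ) (c : ℝ), c ∈ Ioo a b → ContinuousOn u' (Icc a b) →
      (∀ r ∈ Ico a c, 0 < u' r) → (∀ r ∈ Ioo c b, u' r < 0) → u' c = 0 := by
    intro u u' c hc cu' hup hdown
    have hcc : ContinuousAt u' c := cu'.continuousAt (Icc_mem_nhds hc.1 hc.2)
    apply le_antisymm
    · apply le_of_tendsto (hcc.tendsto.mono_left (nhdsWithin_le_nhds (s := Ioi c)))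
      filter_upwards [Ioo_mem_nhdsGT hc.2] with x hx using (hdown x hx).le
    · apply ge_of_tendsto (hcc.tendsto.mono_left (nhdsWithin_le_nhds (s := Iio c)))
      filter_upwards [Ioo_mem_nhdsLT hc.1] with x hx using (hup x ⟨hx.1.le, hx.2⟩).le
  have z1 := crit u₁ u₁' c₁ hc₁ cu1' hc₁up hc₁down
  have z2 := crit u₂ u₂' c₂ hc₂ cu2' hc₂up hc₂down
  obtain ⟨mono1, M1pos, ρ₁, ρ1mem, ρ1inv, cρ1, cp1, p1pos, dρ1, dp1⟩ :=
    branch j f u₁ u₁' a b c₁ M₁ hc₁ cu1 cu1' du1 du1' u1a hc₁up hM₁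
  obtain ⟨mono2, M2pos, ρ₂, ρ2mem, ρ2inv, cρ2, cp2, p2pos, dρ2, dp2⟩ :=
    branch j f u₂ u₂' a b c₂ M₂ hc₂ cu2 cu2' du2 du2' u2a hc₂up hM₂
  have hM1β : β ≤ M₁ := by
    by_contra hcon
    push Not at hcon
    have h1 := E1 c₁ ⟨hc₁.1.le, hc₁.2.le⟩
    have h2 := Fneg M₁ ⟨M1pos, hcon⟩
    rw [z1, ← hM₁] at h1
    linarith
  have hM2β : β ≤ M₂ := by
    by_contra hcon
    push Not at hcon
    have h1 := E2 c₂ ⟨hc₂.1.le, hc₂.2.le⟩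
    have h2 := Fneg M₂ ⟨M2pos, hcon⟩
    rw [z2, ← hM₂] at h1
    linarith
  have ρ10 : ρ₁ 0 = a := by
    have := ρ1inv a (left_mem_Icc.2 hc₁.1.le)
    rwa [u1a] at this
  have ρ20 : ρ₂ 0 = a := by
    have := ρ2inv a (left_mem_Icc.2 hc₂.1.le)
    rwa [u2a] at this
  have ρ1M : ρ₁ M₁ = c₁ := by
    have := ρ1inv c₁ (right_mem_Icc.2 hc₁.1.le)
    rwa [← hM₁] at this
  have ρ2M : ρ₂ M₂ = c₂ := by
    have := ρ2inv c₂ (right_mem_Icc.2 hc₂.1.le)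
    rwa [← hM₂] at this
  obtain ⟨m, hm⟩ : ∃ m, m = min M₁ M₂ := ⟨_, rfl⟩
  have hmβ : β ≤ m := by rw [hm]; exact le_min hM1β hM2β
  have hm1 : m ≤ M₁ := by rw [hm]; exact min_le_left _ _
  have hm2 : m ≤ M₂ := by rw [hm]; exact min_le_right _ _
  have p2nn : ∀ s ∈ Icc 0 M₂, 0 ≤ u₂' (ρ₂ s) := by
    intro s hs
    rcases eq_or_lt_of_le hs.2 with h | h
    · rw [h, ρ2M, z2]
    · exact (p2pos s ⟨hs.1, h⟩).le
  have p1nn : ∀ s ∈ Icc 0 M₁, 0 ≤ u₁' (ρ₁ s) := by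
    intro s hs
    rcases eq_or_lt_of_le hs.2 with h | h
    · rw [h, ρ1M, z1]
    · exact (p1pos s ⟨hs.1, h⟩).le
  -- phase one on `[0, β]`
  have ph1 := phase j f (Fint f) f ρ₁ ρ₂ (fun s => u₁' (ρ₁ s)) (fun s => u₂' (ρ₂ s)) 0 β
    (cρ1.mono (Icc_subset_Icc_right hM1β)) (cρ2.mono (Icc_subset_Icc_right hM2β))
    (cp1.mono (Icc_subset_Icc_right hM1β)) (cp2.mono (Icc_subset_Icc_right hM2β))
    (cF.mono Icc_subset_Ici_self)
    (fun s hs => dρ1 s ⟨hs.1, hs.2.trans_le hM1β⟩) (fun s hs => dρ2 s ⟨hs.1, hs.2.trans_le hM2β⟩)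
    (fun s hs => dp1 s ⟨hs.1, hs.2.trans_le hM1β⟩) (fun s hs => dp2 s ⟨hs.1, hs.2.trans_le hM2β⟩)
    (fun s hs => dF s hs.1) (fun s _ => le_rfl) (fun s hs => (Fneg s hs).le)
    (fun s hs => ha.trans_le (ρ2mem s ⟨hs.1, hs.2.trans hM2β⟩).1.1)
    (fun s hs => p1pos s ⟨hs.1, hs.2.trans_le hM1β⟩)
    (fun s hs => p2nn s ⟨hs.1, hs.2.trans hM2β⟩)
    (fun s hs => by
      have hh := ρ1mem s ⟨hs.1, hs.2.trans hM1β⟩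
      have := E1 (ρ₁ s) ⟨hh.1.1, hh.1.2.trans hc₁.2.le⟩
      rwa [hh.2] at this)
    (by rw [ρ10, ρ20])
    (by
      simp only [ρ10, ρ20, F0]
      gcongr)
  have ph1β := ph1 β (right_mem_Icc.2 hβ.le)
  -- phase two on `[β, m]`
  have ph2 := phase j f (fun _ => 0) (fun _ => 0) ρ₁ ρ₂ (fun s => u₁' (ρ₁ s))
    (fun s => u₂' (ρ₂ s)) β m
    (cρ1.mono (Icc_subset_Icc hβ.le hm1)) (cρ2.mono (Icc_subset_Icc hβ.le hm2))
    (cp1.mono (Icc_subset_Icc hβ.le hm1)) (cp2.mono (Icc_subset_Icc hβ.le hm2))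
    continuousOn_const
    (fun s hs => dρ1 s ⟨hβ.trans hs.1, hs.2.trans_le hm1⟩)
    (fun s hs => dρ2 s ⟨hβ.trans hs.1, hs.2.trans_le hm2⟩)
    (fun s hs => dp1 s ⟨hβ.trans hs.1, hs.2.trans_le hm1⟩)
    (fun s hs => dp2 s ⟨hβ.trans hs.1, hs.2.trans_le hm2⟩)
    (fun s hs => hasDerivAt_const s 0) (fun s hs => (fpos s (hBβ.trans hs.1)).le)
    (fun s hs => le_rfl)
    (fun s hs => ha.trans_le (ρ2mem s ⟨hβ.le.trans hs.1, hs.2.trans hm2⟩).1.1)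
    (fun s hs => p1pos s ⟨hβ.le.trans hs.1, hs.2.trans_le hm1⟩)
    (fun s hs => p2nn s ⟨hβ.le.trans hs.1, hs.2.trans hm2⟩)
    (fun s hs => by positivity)
    ph1β.1
    (by
      have := ph1β.2.2.1
      rwa [hFβ] at this)
  have comp : ∀ s ∈ Ioc 0 m, ρ₂ s < ρ₁ s := by
    intro s hs
    rcases le_or_gt s β with h | h
    · exact (ph1 s ⟨hs.1.le, h⟩).2.1 hs.1
    · exact (ph2 s ⟨h.le, hs.2⟩).2.1 h
  have hpm := (ph2 m (right_mem_Icc.2 hmβ)).2.2.2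
  have hM12 : M₁ < M₂ := by
    by_contra hcon
    push Not at hcon
    have hmM : m = M₂ := by rw [hm]; exact min_eq_right hcon
    have h1 := p1nn m ⟨hβ.le.trans hmβ, hm1⟩
    try simp only at hpm
    rw [hmM, ρ2M, z2, ← hmM] at hpm
    linarith
  have hmM : m = M₁ := by rw [hm]; exact min_eq_left hM12.le
  rw [hmM] at comp
  have hBM1 : B < M₁ := hBβ.trans_le hM1β
  -- monotonicity of the decreasing branches
  have anti : ∀ (u u' : ℝ → ℝ) (c : ℝ), c ∈ Ioo a b → ContinuousOn u (Icc a b) →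
      (∀ r ∈ Ioo a b, HasDerivAt u (u' r) r) → (∀ r ∈ Ioo c b, u' r < 0) →
      StrictAntiOn u (Icc c b) := by
    intro u u' c hc cu du hdown
    apply strictAntiOn_of_deriv_neg (convex_Icc _ _) (cu.mono (Icc_subset_Icc_left hc.1.le))
    intro x hx
    rw [interior_Icc] at hx
    rw [(du x ⟨hc.1.trans hx.1, hx.2⟩).deriv]
    exact hdown x hx
  have anti1 := anti u₁ u₁' c₁ hc₁ cu1 du1 hc₁down
  have anti2 := anti u₂ u₂' c₂ hc₂ cu2 du2 hc₂down
  have rb1M : rb₁ M₁ = c₁ := by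
    have := hrb₁inv c₁ (left_mem_Icc.2 hc₁.2.le)
    rwa [← hM₁] at this
  rw [rb1M] at hlt
  have hrb2M := hrb₂mem M₁ ⟨M1pos.le, hM12.le⟩
  -- comparison left of `c₁`
  have left : ∀ r ∈ Ioc a c₁, u₁ r < u₂ r := by
    intro r hr
    have hrI : r ∈ Icc a c₁ := ⟨hr.1.le, hr.2⟩
    have hs0 : 0 < u₁ r := u1pos r ⟨hr.1, hr.2.trans_lt hc₁.2⟩
    have hsM : u₁ r ≤ M₁ := by
      rw [hM₁]; exact mono1.monotoneOn hrI (right_mem_Icc.2 hc₁.1.le) hr.2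
    rcases le_or_gt r c₂ with h | h
    · have h1 := comp (u₁ r) ⟨hs0, hsM⟩
      rw [ρ1inv r hrI] at h1
      have h2 := ρ2mem (u₁ r) ⟨hs0.le, hsM.trans hM12.le⟩
      have h3 := mono2 h2.1 ⟨hr.1.le, h⟩ h1
      rwa [h2.2] at h3
    · have h3 := anti2 ⟨h.le, hr.2.trans hc₁.2.le⟩ hrb2M.1 (hr.2.trans_lt hlt)
      rw [hrb2M.2] at h3
      linarith
  by_contra hno
  push Not at hno
  have hBI : B ∈ Icc 0 M₁ := ⟨hB.le, hBM1.le⟩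
  have hρB := ρ1mem B hBI
  have hrB := hrb₁mem B hBI
  have lc : ρ₁ B < c₁ := by
    apply lt_of_le_of_ne hρB.1.2
    intro h
    have := hρB.2
    rw [h, ← hM₁] at this
    linarith
  have la : a < ρ₁ B := by
    apply lt_of_le_of_ne hρB.1.1
    intro h
    have := hρB.2
    rw [← h, u1a] at this
    linarith
  have ec : c₁ < rb₁ B := by
    apply lt_of_le_of_ne hrB.1.1
    intro h
    have := hrB.2
    rw [← h, ← hM₁] at this
    linarith
  have eb : rb₁ B < b := by
    apply lt_of_le_of_ne hrB.1.2
    intro h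
    have := hrB.2
    rw [h, u1b] at this
    linarith
  have right : ∀ r ∈ Ico c₁ (rb₁ B), u₁ r < u₂ r := by
    intro r hr
    by_contra hcon
    push Not at hcon
    have hc1 := left c₁ ⟨hc₁.1, le_rfl⟩
    have cD : ContinuousOn (fun x => u₂ x - u₁ x) (Icc c₁ r) :=
      (cu2.sub cu1).mono (Icc_subset_Icc hc₁.1.le (hr.2.trans eb).le)
    have hiv := intermediate_value_Icc' hr.1 cD
    obtain ⟨x, hx, hx0⟩ := hiv (show (0:ℝ) ∈ _ from ⟨by linarith, by linarith⟩)
    try simp only at hx0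
    have hxc : c₁ < x := by
      apply lt_of_le_of_ne hx.1
      intro h
      rw [← h] at hx0
      linarith
    have hxe : x < rb₁ B := hx.2.trans_lt hr.2
    have hxI : x ∈ Icc c₁ b := ⟨hxc.le, (hxe.trans eb).le⟩
    have s1 : u₁ x < M₁ := by
      rw [hM₁]; exact anti1 (left_mem_Icc.2 hc₁.2.le) hxI hxc
    have s2 : B < u₁ x := by
      have := anti1 hxI hrB.1 hxe
      rwa [hrB.2] at this
    have hxc2 : c₂ ≤ x := by
      by_contra hc
      push Not at hc
      have := mono2 ⟨hc₁.1.le, (hxc.trans hc).le⟩ ⟨(hc₁.1.trans hxc).le, hc.le⟩ hxc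
      linarith
    apply hno (u₁ x) ⟨s2, s1⟩
    rw [hrb₁inv x hxI]
    have : u₁ x = u₂ x := by linarith
    rw [this, hrb₂inv x ⟨hxc2, hxI.2⟩]
  have sub : Icc (ρ₁ B) (rb₁ B) ⊆ Icc a b := Icc_subset_Icc la.le eb.le
  have sub' : Ioo (ρ₁ B) (rb₁ B) ⊆ Ioo a b := Ioo_subset_Ioo la.le eb.le
  refine sturm j f u₁ u₁' u₂ u₂' B (ρ₁ B) (rb₁ B) (ha.trans la) (lc.trans ec)
    (superlin f B hB df hf4a) (cu1.mono sub) (cu1'.mono sub) (cu2.mono sub) (cu2'.mono sub)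
    (fun r hr => du1 r (sub' hr)) (fun r hr => du1' r (sub' hr))
    (fun r hr => du2 r (sub' hr)) (fun r hr => du2' r (sub' hr)) ?_ ?_ hρB.2 hrB.2
    (hc₁up _ ⟨la.le, lc⟩) (hc₁down _ ⟨ec, eb⟩).le
  · intro r hr
    rcases le_or_gt r c₁ with h | h
    · have := mono1 hρB.1 ⟨(la.trans hr.1).le, h⟩ hr.1
      rwa [hρB.2] at this
    · have := anti1 ⟨h.le, (hr.2.trans eb).le⟩ hrB.1 hr.2
      rwa [hrB.2] at this
  · intro r hr
    rcases le_or_gt r c₁ with h | h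
    · exact left r ⟨la.trans_le hr.1, h⟩
    · exact right r ⟨h.le, hr.2⟩
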